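/- Let G=(V,E) be a supply graph and H=(V,D) a demand graph such that (V,D) is a forest, and let x be a feasible solution to the nonnegative cycle LP. Let S ⊆ D be a set of demand edges such that: (i) for every path P in the forest (V,D), Σ_{e∈P} x_e ≥ 2·|S∩P| − 2; and (ii) in the graph obtained from G+H by contracting every connected component (tree) of (V,D) to a single vertex, the vertices corresponding to trees containing at least one edge of S form an independent set. Then |C∩S| ≤ |C∩E| for every cycle C of G+H; that is, S is a feasible NonNegativeCycles solution. -/

import Mathlib

open scoped Classical

noncomputable section

/-- The edge set of a simple closed walk in the multigraph with endpoint map `ends`. -/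
def IsCycle {V ε : Type} (ends : ε → Sym2 V) (C : Finset ε) : Prop :=
  ∃ (n : ℕ) (v : Fin (n + 1) → V) (e : Fin (n + 1) → ε),
    Function.Injective v ∧ Function.Injective e ∧
    (∀ i, ends (e i) = s(v i, v (i + 1))) ∧
    C = Finset.image e Finset.univ

/-- The edge set of a simple (open) path. -/
def IsPath {V ε : Type} (ends : ε → Sym2 V) (P : Finset ε) : Prop :=
  ∃ (n : ℕ) (v : Fin (n + 1) → V) (e : Fin n → ε),
    Function.Injective v ∧ Function.Injective e ∧
    (∀ i : Fin n, ends (e i) = s(v i.castSucc, v i.succ)) ∧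
    P = Finset.image e Finset.univ

/-- The cut `δ(U)`: edges with exactly one endpoint in `U`. -/
def cutF {V ε : Type} [Fintype ε] (ends : ε → Sym2 V) (U : Set V) : Finset ε :=
  Finset.univ.filter (fun e => ∃ a b, ends e = s(a, b) ∧ a ∈ U ∧ b ∉ U)

/-- `U` is nonempty and induces a connected subgraph. -/
def ConnectedOn {V ε : Type} (ends : ε → Sym2 V) (U : Set V) : Prop :=
  U.Nonempty ∧ ∀ a ∈ U, ∀ b ∈ U,
    Relation.ReflTransGen (fun x y => x ∈ U ∧ y ∈ U ∧ ∃ e, ends e = s(x, y)) a b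

/-- The multigraph is connected. -/
def MGConnected {V ε : Type} (ends : ε → Sym2 V) : Prop :=
  ConnectedOn ends Set.univ

/-- `δ(U)` is a simple cut: both sides induce connected subgraphs. -/
def IsSimpleCut {V ε : Type} (ends : ε → Sym2 V) (U : Set V) : Prop :=
  ConnectedOn ends U ∧ ConnectedOn ends Uᶜ

/-- A `D`-cycle: a cycle containing exactly one demand edge. -/
def IsDCycle {V ε : Type} [DecidableEq ε] (ends : ε → Sym2 V) (Dem : Finset ε)
    (C : Finset ε) : Prop :=
  IsCycle ends C ∧ (C ∩ Dem).card = 1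

/-- A `D`-cut: a simple cut containing exactly one demand edge. -/
def IsDCut {V ε : Type} [Fintype ε] [DecidableEq ε] (ends : ε → Sym2 V) (Dem : Finset ε)
    (U : Set V) : Prop :=
  IsSimpleCut ends U ∧ (cutF ends U ∩ Dem).card = 1

/-- Planarity of a multigraph: there is a drawing in the plane with injective vertex
positions and arcs for the edges that are internally disjoint. -/
def IsPlanar {V ε : Type} (ends : ε → Sym2 V) : Prop :=
  ∃ (pos : V → ℝ × ℝ) (arc : ε → ℝ → ℝ × ℝ),
    Function.Injective pos ∧
    (∀ e, ContinuousOn (arc e) (Set.Icc 0 1)) ∧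
    (∀ e a b, ends e = s(a, b) →
      (arc e 0 = pos a ∧ arc e 1 = pos b) ∨ (arc e 0 = pos b ∧ arc e 1 = pos a)) ∧
    (∀ e, Set.InjOn (arc e) (Set.Ico 0 1)) ∧
    (∀ e f, e ≠ f → ∀ s ∈ Set.Ioo (0:ℝ) 1, ∀ t ∈ Set.Icc (0:ℝ) 1, arc e s ≠ arc f t) ∧
    (∀ e, ∀ s ∈ Set.Ioo (0:ℝ) 1, ∀ w, arc e s ≠ pos w)

/-- `a` and `b` lie in the same tree (connected component) of the demand forest. -/
def DemReach {V ε : Type} (ends : ε → Sym2 V) (Dem : Finset ε) (a b : V) : Prop :=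
  Relation.ReflTransGen (fun u w => ∃ e ∈ Dem, ends e = s(u, w)) a b

/-- The tree of the demand forest containing `a` contains an edge of `S`. -/
def InSTree {V ε : Type} (ends : ε → Sym2 V) (Dem S : Finset ε) (a : V) : Prop :=
  ∃ e ∈ S, ∃ u : V, u ∈ ends e ∧ DemReach ends Dem a u

section CycleLP

variable {V ε : Type}

lemma injOn_edges_of_injOn_vertices (ends : ε → Sym2 V) {n : ℕ} {v : ℕ → V} {e : ℕ → ε}
    (hv : Set.InjOn v (Set.Iic n)) (he : ∀ i < n, ends (e i) = s(v i, v (i + 1))) :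
    Set.InjOn e (Set.Iio n) := by
  intro i hi j hj hij
  simp only [Set.mem_Iio] at hi hj
  have h : s(v i, v (i + 1)) = s(v j, v (j + 1)) := by rw [← he i hi, ← he j hj, hij]
  rcases Sym2.eq_iff.mp h with h | h
  · exact hv (Set.mem_Iic.mpr hi.le) (Set.mem_Iic.mpr hj.le) h.1
  · have h1 := hv (Set.mem_Iic.mpr hi.le) (Set.mem_Iic.mpr (by omega)) h.1
    have h2 := hv (Set.mem_Iic.mpr (by omega)) (Set.mem_Iic.mpr hj.le) h.2
    omega

lemma isPath_image_range [DecidableEq ε] (ends : ε → Sym2 V) {n : ℕ} {v : ℕ → V} {e : ℕ → ε}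
    (hv : Set.InjOn v (Set.Iic n)) (he : ∀ i < n, ends (e i) = s(v i, v (i + 1))) :
    IsPath ends ((Finset.range n).image e) := by
  refine ⟨n, fun i => v i, fun i => e i, ?_, ?_, ?_, ?_⟩
  · intro i j hij
    exact Fin.ext (hv (Set.mem_Iic.mpr (by omega)) (Set.mem_Iic.mpr (by omega)) hij)
  · intro i j hij
    exact Fin.ext (injOn_edges_of_injOn_vertices ends hv he i.2 j.2 hij)
  · intro i
    simpa using he i i.2
  · ext f
    simp only [Finset.mem_image, Finset.mem_range, Finset.mem_univ, true_and]
    exact ⟨fun ⟨i, hi, h⟩ => ⟨⟨i, hi⟩, h⟩, fun ⟨i, h⟩ => ⟨i, i.2, h⟩⟩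

lemma isCycle_insert_image_range [DecidableEq ε] (ends : ε → Sym2 V) {n : ℕ} {v : ℕ → V}
    {e : ℕ → ε} (hv : Set.InjOn v (Set.Iic n)) (he : ∀ i < n, ends (e i) = s(v i, v (i + 1)))
    {f : ε} (hf : ∀ i < n, e i ≠ f) (hfe : ends f = s(v 0, v n)) :
    IsCycle ends (insert f ((Finset.range n).image e)) := by
  have hinj := injOn_edges_of_injOn_vertices ends hv he
  refine ⟨n, fun i => v i, fun i => if (i : ℕ) < n then e i else f, ?_, ?_, ?_, ?_⟩
  · intro i j hij
    exact Fin.ext (hv (Set.mem_Iic.mpr (by omega)) (Set.mem_Iic.mpr (by omega)) hij)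
  · intro i j hij
    dsimp only at hij
    split_ifs at hij with h1 h2 h2
    · exact Fin.ext (hinj h1 h2 hij)
    · exact absurd hij (hf _ h1)
    · exact absurd hij.symm (hf _ h2)
    · exact Fin.ext (by omega)
  · intro i
    dsimp only
    rw [Fin.val_add_one]
    split_ifs with h1 h2 h2
    · exact absurd h1 (by simp [h2])
    · exact he i h1
    · rw [hfe, h2, Sym2.eq_swap]; simp
    · exact absurd (Fin.ext (by simp; omega)) h2
  · ext g
    simp only [Finset.mem_insert, Finset.mem_image, Finset.mem_range, Finset.mem_univ, true_and]
    constructor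
    · rintro (rfl | ⟨i, hi, rfl⟩)
      · exact ⟨Fin.last n, by simp⟩
      · exact ⟨⟨i, by omega⟩, by simp [hi]⟩
    · rintro ⟨i, rfl⟩
      split_ifs with h
      · exact Or.inr ⟨i, h, rfl⟩
      · exact Or.inl rfl

lemma DemReach.exists_path [Nonempty ε] {ends : ε → Sym2 V} {F : Finset ε} {a b : V}
    (h : DemReach ends F a b) :
    ∃ (n : ℕ) (v : ℕ → V) (e : ℕ → ε), Set.InjOn v (Set.Iic n) ∧
      (∀ i < n, ends (e i) = s(v i, v (i + 1))) ∧ (∀ i < n, e i ∈ F) ∧ v 0 = a ∧ v n = b := by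
  unfold DemReach at h
  induction h with
  | refl =>
    exact ⟨0, fun _ => a, fun _ => Classical.arbitrary ε,
      by intro i hi j hj _; simp at hi hj; omega, by simp, by simp, rfl, rfl⟩
  | @tail b c _ hbc ih =>
    obtain ⟨n, v, e, hv, he, hF, h0, hn⟩ := ih
    obtain ⟨f, hf, hfe⟩ := hbc
    by_cases hc : ∃ i ≤ n, v i = c
    · obtain ⟨i, hi, rfl⟩ := hc
      exact ⟨i, v, e, hv.mono (Set.Iic_subset_Iic.mpr hi), fun j hj => he j (by omega),
        fun j hj => hF j (by omega), h0, rfl⟩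
    · push Not at hc
      refine ⟨n + 1, fun i => if i ≤ n then v i else c, fun i => if i < n then e i else f,
        ?_, ?_, ?_, by simpa using h0, by simp⟩
      · intro i hi j hj hij
        simp only [Set.mem_Iic] at hi hj
        dsimp only at hij
        split_ifs at hij with h1 h2 h2
        · exact hv h1 h2 hij
        · exact absurd hij (hc i h1)
        · exact absurd hij.symm (hc j h2)
        · omega
      · intro i hi
        by_cases h : i < n
        · simpa [h, h.le, Nat.succ_le_of_lt h] using he i h
        · obtain rfl : i = n := by omega
          simp [hfe, hn]
      · intro i hi
        dsimp only
        split_ifs with h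
        · exact hF i h
        · exact hf

lemma DemReach.exists_isPath_isCycle [DecidableEq ε] {ends : ε → Sym2 V} {F : Finset ε} {a b : V}
    (h : DemReach ends F a b) {f : ε} (hf : f ∉ F) (hfe : ends f = s(a, b)) :
    ∃ P ⊆ F, IsPath ends P ∧ IsCycle ends (insert f P) := by
  have : Nonempty ε := ⟨f⟩
  obtain ⟨n, v, e, hv, he, hF, rfl, rfl⟩ := h.exists_path
  refine ⟨(Finset.range n).image e, ?_, isPath_image_range ends hv he,
    isCycle_insert_image_range ends hv he (fun i hi h => hf (h ▸ hF i hi)) hfe⟩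
  intro g hg
  obtain ⟨i, hi, rfl⟩ := Finset.mem_image.mp hg
  exact hF i (Finset.mem_range.mp hi)

lemma DemReach.symm {ends : ε → Sym2 V} {F : Finset ε} {a b : V} (h : DemReach ends F a b) :
    DemReach ends F b a := by
  induction h with
  | refl => exact Relation.ReflTransGen.refl
  | tail _ hbc ih =>
    obtain ⟨e, he, h⟩ := hbc
    exact Relation.ReflTransGen.head ⟨e, he, by rw [h, Sym2.eq_swap]⟩ ih

/-- The mod 2 incidence vector of a vertex pair; loops have incidence vector `0`. -/
def incidence (p : Sym2 V) : V → ZMod 2 :=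
  Sym2.lift ⟨fun a b => Pi.single a 1 + Pi.single b 1, fun _ _ => add_comm _ _⟩ p

lemma incidence_mk (a b : V) :
    incidence s(a, b) = Pi.single a (1 : ZMod 2) + Pi.single b 1 := rfl

/-- Every vertex has even degree in the edge set `F`. -/
def IsEvenSet (ends : ε → Sym2 V) (F : Finset ε) : Prop :=
  ∑ e ∈ F, incidence (ends e) = 0

lemma pi_zmod_two_add_self (f : V → ZMod 2) : f + f = 0 := by
  ext v; exact CharTwo.add_self_eq_zero _

lemma IsCycle.isEvenSet {ends : ε → Sym2 V} {C : Finset ε} (hC : IsCycle ends C) :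
    IsEvenSet ends C := by
  obtain ⟨n, v, e, hv, he, hends, rfl⟩ := hC
  unfold IsEvenSet
  rw [Finset.sum_image (fun i _ j _ h => he h)]
  simp only [hends, incidence_mk]
  have hshift := Equiv.sum_comp (Equiv.addRight (1 : Fin (n + 1)))
    (fun i => (Pi.single (v i) 1 : V → ZMod 2))
  simp only [Equiv.coe_addRight] at hshift
  rw [Finset.sum_add_distrib, hshift]
  exact pi_zmod_two_add_self _

lemma IsEvenSet.symmDiff [DecidableEq ε] {ends : ε → Sym2 V} {F F' : Finset ε}
    (hF : IsEvenSet ends F) (hF' : IsEvenSet ends F') : IsEvenSet ends (symmDiff F F') := by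
  unfold IsEvenSet at *
  have h1 := Finset.sum_inter_add_sum_sdiff F F' (fun e => incidence (ends e))
  have h2 := Finset.sum_inter_add_sum_sdiff F' F (fun e => incidence (ends e))
  rw [symmDiff_def, Finset.sup_eq_union,
    Finset.sum_union (Finset.disjoint_left.mpr fun a ha hb =>
      (Finset.mem_sdiff.mp hb).2 (Finset.mem_sdiff.mp ha).1)]
  rw [hF] at h1
  rw [hF', Finset.inter_comm] at h2
  have h3 := pi_zmod_two_add_self (∑ e ∈ F ∩ F', incidence (ends e))
  linear_combination h1 + h2 - h3

lemma IsEvenSet.demReach_erase [Fintype V] [DecidableEq ε] {ends : ε → Sym2 V} {F : Finset ε}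
    (hF : IsEvenSet ends F) {f : ε} (hf : f ∈ F) {a b : V} (hfe : ends f = s(a, b)) :
    DemReach ends (F.erase f) a b := by
  by_contra hab
  set U : Finset V := Finset.univ.filter (fun u => DemReach ends (F.erase f) a u) with hU
  have ha : a ∈ U := by simp [hU, DemReach, Relation.ReflTransGen.refl]
  have hb : b ∉ U := by simpa [hU] using hab
  have key : ∀ p q : V, ∑ u ∈ U, incidence s(p, q) u =
      (if p ∈ U then 1 else 0) + (if q ∈ U then 1 else 0) := by
    intro p q
    simp [incidence_mk, Finset.sum_add_distrib, Pi.single_apply]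
  have h0 : ∑ e ∈ F, ∑ u ∈ U, incidence (ends e) u = 0 := by
    rw [Finset.sum_comm]
    refine Finset.sum_eq_zero fun u _ => ?_
    have := congrFun hF u
    simpa using this
  rw [← Finset.add_sum_erase _ _ hf, hfe, key, if_pos ha, if_neg hb,
    Finset.sum_eq_zero] at h0
  · simp at h0
  · intro g hg
    obtain ⟨p, q, hpq⟩ : ∃ p q, ends g = s(p, q) := by
      induction h : ends g with | _ p q => exact ⟨p, q, rfl⟩
    have hiff : p ∈ U ↔ q ∈ U := by
      simp only [hU, Finset.mem_filter, Finset.mem_univ, true_and]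
      exact ⟨fun h => h.tail ⟨g, hg, hpq⟩, fun h => h.tail ⟨g, hg, by rw [hpq, Sym2.eq_swap]⟩⟩
    rw [hpq, key]
    by_cases hq : q ∈ U
    · simp only [hiff, hq, if_true]; exact CharTwo.add_self_eq_zero _
    · simp [hiff, hq]

lemma IsEvenSet.exists_isCycle_subset [Fintype V] [DecidableEq ε] {ends : ε → Sym2 V}
    {F : Finset ε} (hF : IsEvenSet ends F) (hne : F.Nonempty) :
    ∃ C ⊆ F, C.Nonempty ∧ IsCycle ends C := by
  obtain ⟨f, hf⟩ := hne
  obtain ⟨a, b, hab⟩ : ∃ a b, ends f = s(a, b) := by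
    induction h : ends f with | _ p q => exact ⟨p, q, rfl⟩
  obtain ⟨P, hPF, -, hC⟩ :=
    (hF.demReach_erase hf hab).exists_isPath_isCycle (Finset.notMem_erase f F) hab
  exact ⟨insert f P, Finset.insert_subset hf (hPF.trans (Finset.erase_subset _ _)),
    Finset.insert_nonempty _ _, hC⟩

/-- A cycle can be traversed so that a prescribed edge comes last. -/
lemma IsCycle.exists_traversal [DecidableEq ε] {ends : ε → Sym2 V} {C : Finset ε}
    (hC : IsCycle ends C) {f : ε} (hf : f ∈ C) :
    ∃ (n : ℕ) (v : ℕ → V) (e : ℕ → ε), Set.InjOn v (Set.Iic n) ∧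
      Set.InjOn e (Set.Iic n) ∧ (∀ i, ends (e i) = s(v i, v (i + 1))) ∧ v (n + 1) = v 0 ∧
      e n = f ∧ C = (Finset.range (n + 1)).image e := by
  obtain ⟨n, v, e, hv, he, hends, hCe⟩ := hC
  obtain rfl : C = Finset.univ.image e := by rw [hCe]; ext g; simp
  obtain ⟨k, -, rfl⟩ := Finset.mem_image.mp hf
  have hinj : Set.InjOn (fun i : ℕ => Fin.ofNat (n + 1) (i + k + 1)) (Set.Iic n) := by
    intro i hi j hj hij
    simp only [Set.mem_Iic] at hi hj
    have h := congrArg Fin.val hij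
    simp only [Fin.val_ofNat] at h
    have h' : i + (k + 1) ≡ j + (k + 1) [MOD n + 1] := by simpa [Nat.ModEq, add_assoc] using h
    exact Nat.ModEq.eq_of_lt_of_lt (Nat.ModEq.add_right_cancel' _ h') (by omega) (by omega)
  refine ⟨n, fun i => v (Fin.ofNat (n + 1) (i + k + 1)), fun i => e (Fin.ofNat (n + 1) (i + k + 1)),
    fun i hi j hj h => hinj hi hj (hv h), fun i hi j hj h => hinj hi hj (he h), ?_, ?_, ?_, ?_⟩
  · intro i
    rw [hends]
    congr 3
    apply Fin.ext
    simp [Fin.val_add, add_right_comm]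
  · refine congrArg v (Fin.ext ?_)
    simp only [Fin.val_ofNat]
    rw [show n + 1 + k + 1 = 0 + k + 1 + (n + 1) by ring, Nat.add_mod_right]
  · refine congrArg e (Fin.ext ?_)
    simp only [Fin.val_ofNat]
    rw [show n + k + 1 = k + (n + 1) by ring, Nat.add_mod_right, Nat.mod_eq_of_lt k.2]
  · symm
    apply Finset.eq_of_subset_of_card_le
    · intro g hg
      obtain ⟨i, -, rfl⟩ := Finset.mem_image.mp hg
      simp
    · rw [Finset.card_image_of_injective _ he, Finset.card_image_of_injOn]
      · simp
      · intro i hi j hj h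
        simp only [Finset.coe_range, Set.mem_Iio] at hi hj
        exact hinj (Set.mem_Iic.mpr (by omega)) (Set.mem_Iic.mpr (by omega)) (he h)

lemma demReach_of_walk {ends : ε → Sym2 V} {F : Finset ε} {v : ℕ → V} {e : ℕ → ε}
    (hends : ∀ i, ends (e i) = s(v i, v (i + 1))) {p q : ℕ} (hpq : p ≤ q)
    (hF : ∀ i, p ≤ i → i < q → e i ∈ F) : DemReach ends F (v p) (v q) := by
  induction q, hpq using Nat.le_induction with
  | base => exact Relation.ReflTransGen.refl
  | succ q hq ih =>
    exact (ih fun i h1 h2 => hF i h1 (by omega)).tail ⟨e q, hF q hq (by omega), hends q⟩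

/-- The path inequality for a walk segment of demand edges, with the slack charged to the two
end vertices when they lie in a tree meeting `S`. -/
lemma segment_le [DecidableEq ε] {ends : ε → Sym2 V} {Dem S : Finset ε} {x : ε → ℝ}
    (hx0 : ∀ e ∈ Dem, 0 ≤ x e)
    (hpath : ∀ P : Finset ε, P ⊆ Dem → IsPath ends P →
      2 * ((S ∩ P).card : ℝ) - 2 ≤ ∑ e ∈ P, x e)
    {n : ℕ} {v : ℕ → V} {e : ℕ → ε} (hv : Set.InjOn v (Set.Iic n))
    (hends : ∀ i, ends (e i) = s(v i, v (i + 1)))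
    {p q : ℕ} (hpq : p ≤ q) (hq : q ≤ n) (hD : ∀ i, p ≤ i → i < q → e i ∈ Dem) :
    ∑ i ∈ Finset.Ico p q, ((if e i ∈ S then (2 : ℝ) else 0) - if e i ∈ Dem then x (e i) else 0) ≤
      (if InSTree ends Dem S (v p) then 1 else 0) +
        (if InSTree ends Dem S (v q) then 1 else 0) := by
  by_cases hS : ∃ i, p ≤ i ∧ i < q ∧ e i ∈ S
  · obtain ⟨i, hpi, hiq, hiS⟩ := hS
    have h1 : InSTree ends Dem S (v p) := ⟨e i, hiS, v i, by simp [hends],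
      demReach_of_walk hends hpi fun j h1 h2 => hD j h1 (by omega)⟩
    have h2 : InSTree ends Dem S (v q) := ⟨e i, hiS, v (i + 1), by simp [hends],
      (demReach_of_walk hends (by omega) fun j h1 h2 => hD j (by omega) h2).symm⟩
    rw [if_pos h1, if_pos h2]
    have hw : Set.InjOn (fun j => v (p + j)) (Set.Iic (q - p)) := by
      intro j hj k hk h
      simp only [Set.mem_Iic] at hj hk
      have := hv (Set.mem_Iic.mpr (by omega)) (Set.mem_Iic.mpr (by omega)) h
      omega
    have hwe : ∀ j < q - p, ends (e (p + j)) = s(v (p + j), v (p + (j + 1))) :=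
      fun j _ => hends _
    have hinj := injOn_edges_of_injOn_vertices (v := fun j => v (p + j))
      (e := fun j => e (p + j)) ends hw hwe
    have hinj' : Set.InjOn (fun j => e (p + j)) (Finset.range (q - p) : Set ℕ) := by
      simpa using hinj
    have hP := hpath ((Finset.range (q - p)).image fun j => e (p + j)) (by
        intro g hg
        obtain ⟨j, hj, rfl⟩ := Finset.mem_image.mp hg
        exact hD _ (by omega) (by have := Finset.mem_range.mp hj; omega))
      (isPath_image_range ends hw hwe)
    rw [Finset.sum_image hinj', Finset.inter_comm, ← Finset.filter_mem_eq_inter,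
      Finset.card_filter, Finset.sum_image hinj'] at hP
    push_cast at hP
    rw [Finset.mul_sum] at hP
    rw [Finset.sum_Ico_eq_sum_range, Finset.sum_sub_distrib]
    have h3 : ∑ j ∈ Finset.range (q - p), (if e (p + j) ∈ Dem then x (e (p + j)) else 0) =
        ∑ j ∈ Finset.range (q - p), x (e (p + j)) :=
      Finset.sum_congr rfl fun j hj =>
        if_pos (hD _ (by omega) (by have := Finset.mem_range.mp hj; omega))
    rw [h3]
    simp only [mul_ite, mul_one, mul_zero] at hP
    linarith
  · push Not at hS
    refine (Finset.sum_nonpos fun i hi => ?_).trans (by positivity)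
    obtain ⟨h1, h2⟩ := Finset.mem_Ico.mp hi
    rw [if_neg (hS i h1 h2), if_pos (hD i h1 h2)]
    linarith [hx0 _ (hD i h1 h2)]

/-- Summing `segment_le` over an initial piece of a walk. -/
lemma initial_walk_le [DecidableEq ε] {ends : ε → Sym2 V} {Dem S : Finset ε} (hSD : S ⊆ Dem) {x : ε → ℝ}
    (hx0 : ∀ e ∈ Dem, 0 ≤ x e)
    (hpath : ∀ P : Finset ε, P ⊆ Dem → IsPath ends P →
      2 * ((S ∩ P).card : ℝ) - 2 ≤ ∑ e ∈ P, x e)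
    {n : ℕ} {v : ℕ → V} {e : ℕ → ε} (hv : Set.InjOn v (Set.Iic n))
    (hends : ∀ i, ends (e i) = s(v i, v (i + 1))) (q : ℕ) (hq : q ≤ n) :
    ∑ i ∈ Finset.range q, ((if e i ∈ S then (2 : ℝ) else 0) - if e i ∈ Dem then x (e i) else 0) ≤
      ∑ i ∈ Finset.range q, (if e i ∈ Dem then 0 else
        (if InSTree ends Dem S (v i) then (1 : ℝ) else 0) +
          (if InSTree ends Dem S (v (i + 1)) then 1 else 0)) +
      (if InSTree ends Dem S (v 0) then 1 else 0) +
        (if InSTree ends Dem S (v q) then 1 else 0) := by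
  induction q using Nat.strong_induction_on with
  | _ q ih =>
  by_cases hE : ∃ i < q, e i ∉ Dem
  · set J := (Finset.range q).filter (fun i => e i ∉ Dem) with hJ
    have hJne : J.Nonempty := by
      obtain ⟨i, hi, h⟩ := hE
      exact ⟨i, by simp [hJ, hi, h]⟩
    obtain ⟨p, hp, hmax⟩ : ∃ p ∈ J, ∀ i ∈ J, i ≤ p :=
      ⟨J.max' hJne, J.max'_mem hJne, fun i hi => J.le_max' i hi⟩
    obtain ⟨hpq, hpD⟩ : p < q ∧ e p ∉ Dem := by simpa [hJ] using hp
    have hD : ∀ i, p + 1 ≤ i → i < q → e i ∈ Dem := by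
      intro i h1 h2
      by_contra h
      have := hmax i (by simp [hJ, h2, h])
      omega
    have h1 := ih p hpq (by omega)
    have h2 := segment_le hx0 hpath hv hends (p := p + 1) (q := q) hpq hq hD
    rw [← Finset.sum_range_add_sum_Ico _ (show p + 1 ≤ q from hpq),
      ← Finset.sum_range_add_sum_Ico _ (show p + 1 ≤ q from hpq), Finset.sum_range_succ,
      Finset.sum_range_succ, if_neg hpD, if_neg hpD, if_neg (fun h => hpD (hSD h))]
    have h3 : ∑ i ∈ Finset.Ico (p + 1) q, (if e i ∈ Dem then 0 else
        (if InSTree ends Dem S (v i) then (1 : ℝ) else 0) +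
          (if InSTree ends Dem S (v (i + 1)) then 1 else 0)) = 0 :=
      Finset.sum_eq_zero fun i hi =>
        if_pos (hD i (Finset.mem_Ico.mp hi).1 (Finset.mem_Ico.mp hi).2)
    rw [h3]
    linarith
  · push Not at hE
    have h := segment_le hx0 hpath hv hends (Nat.zero_le q) hq fun i _ h => hE i h
    rw [← Finset.range_eq_Ico] at h
    have h3 : ∑ i ∈ Finset.range q, (if e i ∈ Dem then 0 else
        (if InSTree ends Dem S (v i) then (1 : ℝ) else 0) +
          (if InSTree ends Dem S (v (i + 1)) then 1 else 0)) = 0 :=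
      Finset.sum_eq_zero fun i hi => if_pos (hE i (Finset.mem_range.mp hi))
    rw [h3]
    linarith

/-- The cycle inequality for cycles whose supply edges all join different trees. -/
lemma card_inter_le_of_no_intra_tree_edge [DecidableEq ε] {ends : ε → Sym2 V} {Dem S : Finset ε}
    (hforest : ∀ C : Finset ε, C ⊆ Dem → ¬ IsCycle ends C) (hSD : S ⊆ Dem) {x : ε → ℝ}
    (hx0 : ∀ e ∈ Dem, 0 ≤ x e)
    (hxC : ∀ C : Finset ε, IsCycle ends C → ∑ e ∈ C ∩ Dem, x e ≤ ((C \ Dem).card : ℝ))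
    (hpath : ∀ P : Finset ε, P ⊆ Dem → IsPath ends P →
      2 * ((S ∩ P).card : ℝ) - 2 ≤ ∑ e ∈ P, x e)
    (hind : ∀ e, e ∉ Dem → ∀ a b : V, ends e = s(a, b) →
      InSTree ends Dem S a → InSTree ends Dem S b → DemReach ends Dem a b)
    {C : Finset ε} (hC : IsCycle ends C)
    (hinter : ∀ e ∈ C, e ∉ Dem → ∀ a b, ends e = s(a, b) → ¬ DemReach ends Dem a b) :
    (C ∩ S).card ≤ (C \ Dem).card := by
  obtain ⟨f, hfC, hfD⟩ := Finset.not_subset.mp fun h => hforest C h hC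
  have hLP := hxC C hC
  obtain ⟨n, v, e, hv, he, hends, hclosed, rfl, rfl⟩ := hC.exists_traversal hfC
  have he' : Set.InjOn e (Finset.range (n + 1) : Set ℕ) := by
    intro i hi j hj h
    simp only [Finset.coe_range, Set.mem_Iio] at hi hj
    exact he (Set.mem_Iic.mpr (by omega)) (Set.mem_Iic.mpr (by omega)) h
  have hpre := initial_walk_le hSD hx0 hpath hv hends n le_rfl
  have hcharge : ∀ i ∈ Finset.range (n + 1), (if e i ∈ Dem then 0 else
        (if InSTree ends Dem S (v i) then (1 : ℝ) else 0) +
          (if InSTree ends Dem S (v (i + 1)) then 1 else 0)) ≤ if e i ∈ Dem then 0 else 1 := by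
    intro i hi
    split_ifs with h h1 h2 <;> try norm_num
    exact hinter (e i) (Finset.mem_image_of_mem e hi) h _ _ (hends i)
      (hind _ h _ _ (hends i) h1 h2)
  have hsum := Finset.sum_le_sum hcharge
  rw [Finset.sum_range_succ, if_neg hfD, hclosed] at hsum
  have hS : ((((Finset.range (n + 1)).image e) ∩ S).card : ℝ) =
      ∑ i ∈ Finset.range (n + 1), if e i ∈ S then 1 else 0 := by
    rw [← Finset.filter_mem_eq_inter, Finset.card_filter, Finset.sum_image he']
    push_cast
    rfl
  have hE : ((((Finset.range (n + 1)).image e) \ Dem).card : ℝ) =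
      ∑ i ∈ Finset.range (n + 1), if e i ∈ Dem then 0 else 1 := by
    rw [Finset.sdiff_eq_filter, Finset.card_filter, Finset.sum_image he']
    push_cast
    exact Finset.sum_congr rfl fun i _ => by split_ifs <;> simp_all
  have hX : ∑ g ∈ ((Finset.range (n + 1)).image e) ∩ Dem, x g =
      ∑ i ∈ Finset.range (n + 1), if e i ∈ Dem then x (e i) else 0 := by
    rw [← Finset.filter_mem_eq_inter, Finset.sum_filter, Finset.sum_image he']
  have hS' : ((((Finset.range (n + 1)).image e) ∩ S).card : ℝ) * 2 =
      ∑ i ∈ Finset.range n, if e i ∈ S then 2 else 0 := by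
    rw [hS, Finset.sum_range_succ, if_neg fun h => hfD (hSD h), add_zero, Finset.sum_mul]
    exact Finset.sum_congr rfl fun i _ => by split_ifs <;> norm_num
  rw [hX, Finset.sum_range_succ, if_neg hfD] at hLP
  rw [Finset.sum_sub_distrib, ← hS'] at hpre
  rw [← hE] at hsum
  have : ((((Finset.range (n + 1)).image e) ∩ S).card : ℝ) ≤
      (((Finset.range (n + 1)).image e) \ Dem).card := by linarith
  exact_mod_cast this

/-- The inequality for even edge sets whose supply edges all join different trees. -/
lemma IsEvenSet.card_inter_le_of_forall_isCycle [Fintype V] [DecidableEq ε] {ends : ε → Sym2 V}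
    {Dem S : Finset ε} {F : Finset ε} (hF : IsEvenSet ends F)
    (hcyc : ∀ C ⊆ F, IsCycle ends C → (C ∩ S).card ≤ (C \ Dem).card) :
    (F ∩ S).card ≤ (F \ Dem).card := by
  induction F using Finset.strongInduction with
  | _ F ih =>
  rcases F.eq_empty_or_nonempty with rfl | hne
  · simp
  obtain ⟨C, hCF, hCne, hC⟩ := hF.exists_isCycle_subset hne
  have hss : F \ C ⊂ F := Finset.sdiff_ssubset hCF hCne
  have heven : IsEvenSet ends (F \ C) := by
    have h := hF.symmDiff hC.isEvenSet
    rwa [symmDiff_of_ge hCF] at h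
  have h1 := ih (F \ C) hss heven fun C' h => hcyc C' (h.trans hss.subset)
  have h2 := hcyc C hCF hC
  have hS : (F ∩ S).card = ((F \ C) ∩ S).card + (C ∩ S).card := by
    rw [← Finset.card_union_of_disjoint, ← Finset.union_inter_distrib_right,
      Finset.sdiff_union_of_subset hCF]
    exact Finset.disjoint_of_subset_left Finset.inter_subset_left
      (Finset.disjoint_of_subset_right Finset.inter_subset_left Finset.sdiff_disjoint)
  have hE : (F \ Dem).card = ((F \ C) \ Dem).card + (C \ Dem).card := by
    rw [← Finset.card_union_of_disjoint, ← Finset.union_sdiff_distrib,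
      Finset.sdiff_union_of_subset hCF]
    exact Finset.disjoint_of_subset_left Finset.sdiff_subset
      (Finset.disjoint_of_subset_right Finset.sdiff_subset Finset.sdiff_disjoint)
  omega

/-- The fundamental cycle of a supply edge inside a tree has at most one edge of `S`. -/
lemma exists_fundamental_cycle [DecidableEq ε] {ends : ε → Sym2 V} {Dem S : Finset ε}
    {x : ε → ℝ}
    (hxC : ∀ C : Finset ε, IsCycle ends C → ∑ e ∈ C ∩ Dem, x e ≤ ((C \ Dem).card : ℝ))
    (hpath : ∀ P : Finset ε, P ⊆ Dem → IsPath ends P →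
      2 * ((S ∩ P).card : ℝ) - 2 ≤ ∑ e ∈ P, x e)
    {f : ε} (hf : f ∉ Dem) {a b : V} (hfe : ends f = s(a, b)) (hab : DemReach ends Dem a b) :
    ∃ P ⊆ Dem, IsCycle ends (insert f P) ∧ (P ∩ S).card ≤ 1 := by
  obtain ⟨P, hPD, hP, hC⟩ := hab.exists_isPath_isCycle hf hfe
  refine ⟨P, hPD, hC, ?_⟩
  have h1 := hxC _ hC
  have h2 := hpath P hPD hP
  rw [Finset.insert_inter_of_notMem hf, Finset.inter_eq_left.mpr hPD,
    Finset.insert_sdiff_of_notMem _ hf, Finset.sdiff_eq_empty_iff_subset.mpr hPD] at h1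
  rw [Finset.inter_comm] at h2
  simp only [insert_empty_eq, Finset.card_singleton, Nat.cast_one] at h1
  have h3 : ((P ∩ S).card : ℝ) < 2 := by linarith
  have h4 : (P ∩ S).card < 2 := by exact_mod_cast h3
  omega

end CycleLP

/-- if `(V,D)` is a forest, `x` is LP-feasible, and `S ⊆ D` satisfies the
path inequality (i) and the tree-independence condition (ii), then `S` is a feasible
`NonNegativeCycles` solution. -/
theorem stmt6 {V ε : Type} [Fintype V] [DecidableEq V] [Fintype ε] [DecidableEq ε]
    (ends : ε → Sym2 V) (Dem : Finset ε)
    (hforest : ∀ C : Finset ε, C ⊆ Dem → ¬ IsCycle ends C)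
    (x : ε → ℝ)
    (hx01 : ∀ e ∈ Dem, 0 ≤ x e ∧ x e ≤ 1)
    (hxC : ∀ C : Finset ε, IsCycle ends C → ∑ e ∈ C ∩ Dem, x e ≤ ((C \ Dem).card : ℝ))
    (S : Finset ε) (hSD : S ⊆ Dem)
    (hpath : ∀ P : Finset ε, P ⊆ Dem → IsPath ends P →
      2 * ((S ∩ P).card : ℝ) - 2 ≤ ∑ e ∈ P, x e)
    (hind : ∀ e, e ∉ Dem → ∀ a b : V, ends e = s(a, b) →
      InSTree ends Dem S a → InSTree ends Dem S b → DemReach ends Dem a b) :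
    ∀ C : Finset ε, IsCycle ends C → (C ∩ S).card ≤ (C \ Dem).card := by
  classical
  have hx0 : ∀ e ∈ Dem, 0 ≤ x e := fun e he => (hx01 e he).1
  suffices H : ∀ (m : ℕ) (F : Finset ε), IsEvenSet ends F →
      (F.filter fun e => e ∉ Dem ∧ ∃ a b, ends e = s(a, b) ∧ DemReach ends Dem a b).card = m →
      (F ∩ S).card ≤ (F \ Dem).card from
    fun C hC => H _ C hC.isEvenSet rfl
  intro m
  induction m with
  | zero =>
    intro F hF hm
    refine hF.card_inter_le_of_forall_isCycle fun C hCF hC =>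
      card_inter_le_of_no_intra_tree_edge hforest hSD hx0 hxC hpath hind hC ?_
    intro e he heD a b hab hreach
    rw [Finset.card_eq_zero, Finset.filter_eq_empty_iff] at hm
    exact hm (hCF he) ⟨heD, a, b, hab, hreach⟩
  | succ m ih =>
    intro F hF hm
    obtain ⟨f, hf⟩ := Finset.card_pos.mp (by rw [hm]; exact m.succ_pos)
    obtain ⟨hfF, hfD, a, b, hab, hreach⟩ := Finset.mem_filter.mp hf
    obtain ⟨P, hPD, hC, hP⟩ := exists_fundamental_cycle hxC hpath hfD hab hreach
    have hmem : ∀ e, e ∉ Dem → (e ∈ symmDiff F (insert f P) ↔ e ∈ F ∧ e ≠ f) := by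
      intro e he
      have heP : e ∉ P := fun h => he (hPD h)
      by_cases hef : e = f
      · simp [Finset.mem_symmDiff, hef, hfF]
      · simp [Finset.mem_symmDiff, hef, heP]
    have h1 := ih (symmDiff F (insert f P)) (hF.symmDiff hC.isEvenSet) (by
      have : (symmDiff F (insert f P)).filter
          (fun e => e ∉ Dem ∧ ∃ a b, ends e = s(a, b) ∧ DemReach ends Dem a b) =
          (F.filter fun e => e ∉ Dem ∧ ∃ a b, ends e = s(a, b) ∧ DemReach ends Dem a b).erase f := by
        ext e
        simp only [Finset.mem_filter, Finset.mem_erase]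
        constructor
        · rintro ⟨h1, h2⟩
          have := (hmem e h2.1).mp h1
          exact ⟨this.2, this.1, h2⟩
        · rintro ⟨h1, h2, h3⟩
          exact ⟨(hmem e h3.1).mpr ⟨h2, h1⟩, h3⟩
      rw [this, Finset.card_erase_of_mem hf, hm, Nat.add_sub_cancel])
    have h2 : (symmDiff F (insert f P) \ Dem).card + 1 = (F \ Dem).card := by
      have : symmDiff F (insert f P) \ Dem = (F \ Dem).erase f := by
        ext e
        simp only [Finset.mem_sdiff, Finset.mem_erase]
        constructor
        · rintro ⟨h1, h2⟩
          have := (hmem e h2).mp h1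
          exact ⟨this.2, this.1, h2⟩
        · rintro ⟨h1, h2, h3⟩
          exact ⟨(hmem e h3).mpr ⟨h2, h1⟩, h3⟩
      rw [this, Finset.card_erase_add_one (Finset.mem_sdiff.mpr ⟨hfF, hfD⟩)]
    have h3 : F ∩ S ⊆ (symmDiff F (insert f P) ∩ S) ∪ (P ∩ S) := by
      intro e he
      obtain ⟨heF, heS⟩ := Finset.mem_inter.mp he
      have hef : e ≠ f := fun h => hfD (h ▸ hSD heS)
      by_cases heP : e ∈ P
      · simp [heP, heS]
      · simp [Finset.mem_symmDiff, heF, heS, heP, hef]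
    have h4 := (Finset.card_le_card h3).trans (Finset.card_union_le _ _)
    omega

end
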